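/- arXiv:2410.07620 — 4 statements merged into one kernel-verified Lean document; each statement's English description precedes it below -/
import Mathlib

section
/- Let e₁ ≤ e₂ be nonnegative integers and let Λ(e₁,e₂) = ℍ[R, t^{e₁}, t^{e₂}] be the corresponding quaternion order over R = k⟦t⟧. Then the quotient of Λ(e₁,e₂) by its Jacobson radical is isomorphic as a k-algebra to: the 2×2 matrix algebra Mat₂(k) if e₁ = e₂ = 0; the product k × k if 0 = e₁ < e₂; and k if 0 < e₁ ≤ e₂. -/
open scoped Quaternion
open PowerSeries

noncomputable section

/-- A surjective ring homomorphism onto a ring with zero Jacobson radical, all of whose kernel elements are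
quasi-regular, has the Jacobson radical as its kernel. -/
theorem ker_eq_jacobson_bot_of_isUnit_one_add {A B : Type*} [Ring A] [Ring B]
    (hB : Ring.jacobson B = ⊥) (f : A →+* B) (hf : Function.Surjective f)
    (hu : ∀ x, f x = 0 → IsUnit (1 + x)) :
    RingHom.ker f = Ideal.jacobson ⊥ := by
  apply le_antisymm
  · intro x hx
    rw [Ideal.mem_jacobson_iff]
    intro y
    obtain ⟨u, hu⟩ := hu (y * x) (by rw [map_mul, (RingHom.mem_ker).1 hx, mul_zero])
    refine ⟨↑u⁻¹, ?_⟩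
    rw [Ideal.mem_bot, mul_assoc, sub_eq_zero, add_comm]
    calc (↑u⁻¹ : A) + ↑u⁻¹ * (y * x) = ↑u⁻¹ * (1 + y * x) := by rw [mul_add, mul_one]
      _ = 1 := by rw [← hu, Units.inv_mul]
  · rw [Ideal.jacobson_bot]
    have : RingHomSurjective f := ⟨hf⟩
    intro x hx
    have h := Ring.le_comap_jacobson f hx
    rwa [hB] at h

namespace QuaternionAlgebra

/-- A quaternion whose reduced norm is a unit is a unit. -/
theorem isUnit_of_isUnit_norm {R : Type*} [CommRing R] {a b : R} (q : ℍ[R, a, b])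
    (h : IsUnit (q.re ^ 2 - a * q.imI ^ 2 - b * q.imJ ^ 2 + a * b * q.imK ^ 2)) :
    IsUnit q := by
  obtain ⟨u, hu⟩ := h
  have key : (↑u⁻¹ : R) * (q.re ^ 2 - a * q.imI ^ 2 - b * q.imJ ^ 2 + a * b * q.imK ^ 2) = 1 := by
    rw [← hu, Units.inv_mul]
  let r : ℍ[R, a, b] := ⟨↑u⁻¹ * q.re, -(↑u⁻¹ * q.imI), -(↑u⁻¹ * q.imJ), -(↑u⁻¹ * q.imK)⟩
  refine ⟨⟨q, r, ?_, ?_⟩, rfl⟩ <;> ext <;> simp [r] <;>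
    first | linear_combination key | ring

variable {k : Type*} [Field k]

theorem algebraMap_eq_mk (a b : PowerSeries k) (c : k) :
    algebraMap k ℍ[PowerSeries k, a, b] c = ⟨C c, 0, 0, 0⟩ :=
  rfl

/-- Reduction modulo the maximal ideal of `ℍ[k⟦t⟧, 1, 1]`, as a map to `Mat₂(k)`. -/
def reductionMatrix :
    ℍ[PowerSeries k, (X : PowerSeries k) ^ 0, (X : PowerSeries k) ^ 0] →ₐ[k]
      Matrix (Fin 2) (Fin 2) k where
  toFun q := !![constantCoeff q.re + constantCoeff q.imI,
                constantCoeff q.imJ + constantCoeff q.imK;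
                constantCoeff q.imJ - constantCoeff q.imK,
                constantCoeff q.re - constantCoeff q.imI]
  map_one' := by ext i j; fin_cases i <;> fin_cases j <;> simp
  map_zero' := by ext i j; fin_cases i <;> fin_cases j <;> simp
  map_add' p q := by ext i j; fin_cases i <;> fin_cases j <;> simp <;> ring
  map_mul' p q := by ext i j; fin_cases i <;> fin_cases j <;> simp <;> ring
  commutes' c := by
    ext i j
    fin_cases i <;> fin_cases j <;> simp [algebraMap_eq_mk, Matrix.algebraMap_matrix_apply]

/-- The residue map `ℍ[k⟦t⟧, 1, t ^ e] → k × k` for `0 < e`. -/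
def reductionProd {e : ℕ} (he : e ≠ 0) :
    ℍ[PowerSeries k, (X : PowerSeries k) ^ 0, (X : PowerSeries k) ^ e] →ₐ[k] k × k where
  toFun q := (constantCoeff q.re + constantCoeff q.imI,
              constantCoeff q.re - constantCoeff q.imI)
  map_one' := by simp
  map_zero' := by simp
  map_add' p q := by ext <;> simp <;> ring
  map_mul' p q := by ext <;> simp [he] <;> ring
  commutes' c := by ext <;> simp [algebraMap_eq_mk]

/-- The residue map `ℍ[k⟦t⟧, t ^ d, t ^ e] → k` for `0 < d` and `0 < e`. -/
def reductionField {d e : ℕ} (hd : d ≠ 0) (he : e ≠ 0) :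
    ℍ[PowerSeries k, (X : PowerSeries k) ^ d, (X : PowerSeries k) ^ e] →ₐ[k] k where
  toFun q := constantCoeff q.re
  map_one' := by simp
  map_zero' := by simp
  map_add' p q := by simp
  map_mul' p q := by simp [hd, he]
  commutes' c := by simp [algebraMap_eq_mk]

end QuaternionAlgebra

open QuaternionAlgebra

/-- Let `Λ(e₁,e₂) = ℍ[k⟦t⟧, t^e₁, t^e₂]` with `e₁ ≤ e₂`.  The quotient of
`Λ(e₁,e₂)` by its Jacobson radical (the intersection of its maximal left ideals, i.e.
`Ideal.jacobson ⊥`) is isomorphic as a `k`-algebra to `Mat₂(k)` if `e₁ = e₂ = 0`, to `k × k`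
if `0 = e₁ < e₂`, and to `k` if `0 < e₁ ≤ e₂`.  "The quotient by the Jacobson radical is
isomorphic to `X`" is rendered as: there is a surjective `k`-algebra homomorphism to `X`
whose kernel is the Jacobson radical. -/
theorem quaternion_order_quotient_by_jacobson_radical
    {k : Type*} [Field k] [CharZero k] [IsAlgClosed k]
    (e₁ e₂ : ℕ) (h : e₁ ≤ e₂) :
    (e₁ = 0 ∧ e₂ = 0 →
      ∃ φ : ℍ[PowerSeries k, (X : PowerSeries k) ^ e₁, (X : PowerSeries k) ^ e₂] →ₐ[k]
          Matrix (Fin 2) (Fin 2) k,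
        Function.Surjective φ ∧ RingHom.ker φ = Ideal.jacobson ⊥) ∧
    (e₁ = 0 ∧ 0 < e₂ →
      ∃ φ : ℍ[PowerSeries k, (X : PowerSeries k) ^ e₁, (X : PowerSeries k) ^ e₂] →ₐ[k] k × k,
        Function.Surjective φ ∧ RingHom.ker φ = Ideal.jacobson ⊥) ∧
    (0 < e₁ →
      ∃ φ : ℍ[PowerSeries k, (X : PowerSeries k) ^ e₁, (X : PowerSeries k) ^ e₂] →ₐ[k] k,
        Function.Surjective φ ∧ RingHom.ker φ = Ideal.jacobson ⊥) := by
  refine ⟨?_, ?_, ?_⟩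
  · rintro ⟨rfl, rfl⟩
    have hsurj : Function.Surjective (reductionMatrix (k := k)) := by
      intro M
      refine ⟨⟨C ((M 0 0 + M 1 1) / 2), C ((M 0 0 - M 1 1) / 2),
        C ((M 0 1 + M 1 0) / 2), C ((M 0 1 - M 1 0) / 2)⟩, ?_⟩
      ext i j
      fin_cases i <;> fin_cases j <;> simp [reductionMatrix] <;> field_simp <;> ring
    refine ⟨reductionMatrix, hsurj, ker_eq_jacobson_bot_of_isUnit_one_add
      (IsSemisimpleRing.jacobson_eq_bot _)
      (reductionMatrix (k := k)).toRingHom hsurj fun x hx => isUnit_of_isUnit_norm _ ?_⟩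
    have h00 : constantCoeff x.re + constantCoeff x.imI = 0 := congrFun (congrFun hx 0) 0
    have h01 : constantCoeff x.imJ + constantCoeff x.imK = 0 := congrFun (congrFun hx 0) 1
    have h10 : constantCoeff x.imJ - constantCoeff x.imK = 0 := congrFun (congrFun hx 1) 0
    have h11 : constantCoeff x.re - constantCoeff x.imI = 0 := congrFun (congrFun hx 1) 1
    have hre : constantCoeff x.re = 0 := by grind
    have hI : constantCoeff x.imI = 0 := by grind
    have hJ : constantCoeff x.imJ = 0 := by grind
    have hK : constantCoeff x.imK = 0 := by grind
    rw [PowerSeries.isUnit_iff_constantCoeff]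
    simp [hre, hI, hJ, hK]
  · rintro ⟨rfl, he⟩
    have hsurj : Function.Surjective (reductionProd (k := k) he.ne') := by
      rintro ⟨a, b⟩
      refine ⟨⟨C ((a + b) / 2), C ((a - b) / 2), 0, 0⟩, ?_⟩
      ext <;> simp [reductionProd] <;> field_simp <;> ring
    refine ⟨reductionProd he.ne', hsurj, ker_eq_jacobson_bot_of_isUnit_one_add
      (IsSemisimpleRing.jacobson_eq_bot _)
      (reductionProd (k := k) he.ne').toRingHom hsurj fun x hx => isUnit_of_isUnit_norm _ ?_⟩
    have h0 : constantCoeff x.re + constantCoeff x.imI = 0 := congrArg Prod.fst hx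
    have h1 : constantCoeff x.re - constantCoeff x.imI = 0 := congrArg Prod.snd hx
    have hre : constantCoeff x.re = 0 := by grind
    have hI : constantCoeff x.imI = 0 := by grind
    rw [PowerSeries.isUnit_iff_constantCoeff]
    simp [hre, hI, he.ne']
  · intro h₁
    have h₂ : 0 < e₂ := h₁.trans_le h
    have hsurj : Function.Surjective (reductionField (k := k) h₁.ne' h₂.ne') := fun a =>
      ⟨⟨C a, 0, 0, 0⟩, by change constantCoeff (C a) = a; simp⟩
    refine ⟨reductionField h₁.ne' h₂.ne', hsurj, ker_eq_jacobson_bot_of_isUnit_one_add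
      (IsSemisimpleRing.jacobson_eq_bot _)
      (reductionField (k := k) h₁.ne' h₂.ne').toRingHom hsurj
      fun x hx => isUnit_of_isUnit_norm _ ?_⟩
    have hre : constantCoeff x.re = 0 := hx
    rw [PowerSeries.isUnit_iff_constantCoeff]
    simp [hre, h₁.ne', h₂.ne']
end
end

section
/- Let e₁ ≤ e₂ be nonnegative integers and let Λ(e₁,e₂) = ℍ[R, t^{e₁}, t^{e₂}] be the corresponding quaternion order over R = k⟦t⟧. Then Λ(e₁,e₂) is hereditary — that is, every left ideal of Λ(e₁,e₂) is projective as a left Λ(e₁,e₂)-module — if and only if e₁ = 0 and e₂ ≤ 1. -/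
open scoped Quaternion
open PowerSeries

noncomputable section

namespace QuadraticAlgebra

variable {R : Type*} [CommRing R] {ϖ : R}

lemma omega_mul_omega : (omega : QuadraticAlgebra R ϖ 0) * omega = algebraMap R _ ϖ := by
  simp [omega_mul_omega_eq_algebraMap]

lemma norm_omega : norm (omega : QuadraticAlgebra R ϖ 0) = -ϖ := by
  simp [norm_def]

lemma irreducible_omega (hϖ : Irreducible ϖ) : Irreducible (omega : QuadraticAlgebra R ϖ 0) := by
  have h : Irreducible (norm (omega : QuadraticAlgebra R ϖ 0)) := by
    rw [norm_omega]
    exact (Associated.refl ϖ).neg_right.irreducible hϖ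
  refine ⟨fun hu => h.not_isUnit (isUnit_iff_norm_isUnit.mp hu), fun {a b} hab => ?_⟩
  rw [isUnit_iff_norm_isUnit, isUnit_iff_norm_isUnit]
  exact h.isUnit_or_isUnit (by rw [hab, map_mul])

variable [IsDomain R] [IsDiscreteValuationRing R]

/-- An element of `R[√ϖ]` whose rational part is a unit is a unit. -/
lemma isUnit_mk_of_not_dvd (hϖ : Irreducible ϖ) {x y : R} (hx : ¬ ϖ ∣ x) :
    IsUnit (⟨x, y⟩ : QuadraticAlgebra R ϖ 0) := by
  rw [isUnit_iff_norm_isUnit]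
  by_contra h
  have h' : ϖ ∣ norm (⟨x, y⟩ : QuadraticAlgebra R ϖ 0) := by
    rw [← Ideal.mem_span_singleton, ← hϖ.maximalIdeal_eq]
    exact h
  simp only [norm_def, zero_mul, add_zero, mul_assoc] at h'
  rw [dvd_sub_left (dvd_mul_right _ _)] at h'
  exact hx (or_self_iff.mp (hϖ.prime.dvd_or_dvd h'))

lemma exists_associated_omega_pow (hϖ : Irreducible ϖ) (n : ℕ) (x y : R)
    (h : ¬ (ϖ ^ n ∣ x ∧ ϖ ^ n ∣ y)) :
    ∃ m : ℕ, Associated (omega ^ m) (⟨x, y⟩ : QuadraticAlgebra R ϖ 0) := by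
  induction n generalizing x y with
  | zero => simp at h
  | succ n ih =>
    by_cases hx : ϖ ∣ x
    · obtain ⟨x, rfl⟩ := hx
      by_cases hy : ϖ ∣ y
      · obtain ⟨y, rfl⟩ := hy
        obtain ⟨m, u, hu⟩ := ih x y fun ⟨h₁, h₂⟩ => h
          ⟨by rw [pow_succ']; exact mul_dvd_mul_left _ h₁,
            by rw [pow_succ']; exact mul_dvd_mul_left _ h₂⟩
        refine ⟨m + 2, u, ?_⟩
        rw [pow_add, mul_right_comm, hu, sq, omega_mul_omega]
        ext <;> simp [mul_comm]
      · obtain ⟨u, hu⟩ := isUnit_mk_of_not_dvd (y := x) hϖ hy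
        refine ⟨1, u, ?_⟩
        rw [hu]
        ext <;> simp
    · obtain ⟨u, hu⟩ := isUnit_mk_of_not_dvd (y := y) hϖ hx
      exact ⟨0, u, by simp [hu]⟩

lemma exists_associated_omega_pow_of_ne_zero (hϖ : Irreducible ϖ) {z : QuadraticAlgebra R ϖ 0}
    (hz : z ≠ 0) : ∃ m : ℕ, Associated (omega ^ m) z := by
  have key : ∀ w : R, w ≠ 0 → ∃ n, ¬ ϖ ^ n ∣ w := fun w hw =>
    let ⟨n, hn⟩ := FiniteMultiplicity.of_prime_left hϖ.prime hw
    ⟨n + 1, hn⟩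
  by_cases hx : z.re = 0
  · have hy : z.im ≠ 0 := fun hy => hz (QuadraticAlgebra.ext hx hy)
    obtain ⟨n, hn⟩ := key _ hy
    exact exists_associated_omega_pow hϖ n z.re z.im fun h => hn h.2
  · obtain ⟨n, hn⟩ := key _ hx
    exact exists_associated_omega_pow hϖ n z.re z.im fun h => hn h.1

lemma norm_ne_zero (hϖ : Irreducible ϖ) {z : QuadraticAlgebra R ϖ 0} (hz : z ≠ 0) :
    norm z ≠ 0 := by
  obtain ⟨m, u, rfl⟩ := exists_associated_omega_pow_of_ne_zero hϖ hz
  rw [map_mul, map_pow, norm_omega]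
  exact mul_ne_zero (pow_ne_zero _ (neg_ne_zero.mpr hϖ.ne_zero))
    (isUnit_iff_norm_isUnit.mp u.isUnit).ne_zero

lemma isDomain_of_irreducible (hϖ : Irreducible ϖ) : IsDomain (QuadraticAlgebra R ϖ 0) := by
  have : NoZeroDivisors (QuadraticAlgebra R ϖ 0) := by
    refine ⟨fun {a b} hab => ?_⟩
    by_contra! h
    apply mul_ne_zero (norm_ne_zero hϖ h.1) (norm_ne_zero hϖ h.2)
    rw [← map_mul, hab, norm_zero]
  exact NoZeroDivisors.to_isDomain _

/-- Adjoining a square root of a uniformizer to a discrete valuation ring gives a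
principal ideal ring. -/
lemma isPrincipalIdealRing_of_irreducible (hϖ : Irreducible ϖ) :
    IsPrincipalIdealRing (QuadraticAlgebra R ϖ 0) := by
  have := isDomain_of_irreducible hϖ
  have := IsDiscreteValuationRing.ofHasUnitMulPowIrreducibleFactorization
    (R := QuadraticAlgebra R ϖ 0)
    ⟨omega, irreducible_omega hϖ, fun hz => exists_associated_omega_pow_of_ne_zero hϖ hz⟩
  infer_instance

end QuadraticAlgebra

section Sections

variable {R : Type*} [CommRing R]

/-- Over a discrete valuation ring, a surjection commuting with square roots of multiplication by
a uniformizer has a section commuting with them, if the target is a lattice. -/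
lemma exists_section_comm_of_irreducible [IsDomain R] [IsDiscreteValuationRing R]
    {ϖ : R} (hϖ : Irreducible ϖ) {M F : Type*} [AddCommGroup M] [AddCommGroup F]
    [Module R M] [Module R F] [Module.Finite R M] [Module.IsTorsionFree R M]
    (jM : Module.End R M) (jF : Module.End R F) (hM : jM * jM = ϖ • 1) (hF : jF * jF = ϖ • 1)
    (p : F →ₗ[R] M) (hp : ∀ x, p (jF x) = jM (p x)) (hsurj : Function.Surjective p) :
    ∃ s : M →ₗ[R] F, (∀ m, p (s m) = m) ∧ ∀ m, s (jM m) = jF (s m) := by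
  let S := QuadraticAlgebra R ϖ 0
  have := QuadraticAlgebra.isDomain_of_irreducible hϖ
  have := QuadraticAlgebra.isPrincipalIdealRing_of_irreducible hϖ
  let φM : S →ₐ[R] Module.End R M := QuadraticAlgebra.lift ⟨jM, by simpa using hM⟩
  let φF : S →ₐ[R] Module.End R F := QuadraticAlgebra.lift ⟨jF, by simpa using hF⟩
  let : Module S M := Module.compHom M φM.toRingHom
  let : Module S F := Module.compHom F φF.toRingHom
  have smulM (z : S) (m : M) : z • m = z.re • m + z.im • jM m := by
    change (z.re • (1 : Module.End R M) + z.im • jM) m = _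
    simp
  have smulF (z : S) (m : F) : z • m = z.re • m + z.im • jF m := by
    change (z.re • (1 : Module.End R F) + z.im • jF) m = _
    simp
  have algM (r : R) (m : M) : algebraMap R S r • m = r • m := by
    rw [smulM]
    simp [S]
  have algF (r : R) (m : F) : algebraMap R S r • m = r • m := by
    rw [smulF]
    simp [S]
  have : IsScalarTower R S M := IsScalarTower.of_algebraMap_smul algM
  have : IsScalarTower R S F := IsScalarTower.of_algebraMap_smul algF
  have : Module.Finite S M := Module.Finite.of_restrictScalars_finite R S M
  have : Module.IsTorsionFree S M := by
    refine Module.IsTorsionFree.of_smul_eq_zero fun z m hzm => ?_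
    by_contra! h
    apply smul_ne_zero (QuadraticAlgebra.norm_ne_zero hϖ h.1) h.2
    rw [← algM, QuadraticAlgebra.algebraMap_norm_eq_mul_star, mul_comm, mul_smul, hzm, smul_zero]
  let pS : F →ₗ[S] M :=
    { toFun := p
      map_add' := map_add p
      map_smul' := fun z m => by simp [smulM, smulF, hp] }
  obtain ⟨s, hs⟩ := Module.projective_lifting_property pS LinearMap.id hsurj
  refine ⟨s.restrictScalars R, fun m => LinearMap.congr_fun hs m, fun m => ?_⟩
  have := map_smul s (QuadraticAlgebra.omega : S) m
  rw [smulM, smulF] at this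
  simpa [S] using this

/-- Averaging a section over the group generated by an involution `u` makes it commute with `u`,
and preserves equivariance under elements commuting or anticommuting with `u`. -/
lemma exists_section_comm_of_mul_self_eq_one [Invertible (2 : R)] {A : Type*} [Ring A]
    [Algebra R A] {M F : Type*} [AddCommGroup M] [AddCommGroup F] [Module R M] [Module R F]
    [Module A M] [Module A F] [IsScalarTower R A M] [IsScalarTower R A F]
    (p : F →ₗ[A] M) (s : M →ₗ[R] F) (hs : ∀ m, p (s m) = m) (u : A) (hu : u * u = 1) :
    ∃ s' : M →ₗ[R] F, (∀ m, p (s' m) = m) ∧ (∀ m, s' (u • m) = u • s' m) ∧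
      ∀ v : A, v * u = -(u * v) → (∀ m, s (v • m) = v • s m) →
        ∀ m, s' (v • m) = v • s' m := by
  have huM (m : M) : u • u • m = m := by rw [smul_smul, hu, one_smul]
  have huF (m : F) : u • u • m = m := by rw [smul_smul, hu, one_smul]
  refine ⟨⅟(2 : R) • (s + Algebra.lsmul R R F u ∘ₗ s ∘ₗ Algebra.lsmul R R M u), fun m => ?_,
    fun m => ?_, fun v hv hsv m => ?_⟩
  · simp [LinearMap.map_smul_of_tower, hs, huM]
  · simp [huM, huF, smul_comm u (⅟(2 : R)), add_comm]
  · have h₁ : u • v • m = -(v • u • m) := by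
      rw [smul_smul, smul_smul, ← neg_smul, hv, neg_neg]
    have h₂ (x : F) : u • v • x = -(v • u • x) := by
      rw [smul_smul, smul_smul, ← neg_smul, hv, neg_neg]
    simp [h₁, h₂, hsv, smul_comm v (⅟(2 : R))]

end Sections

namespace QuaternionAlgebra

variable {R : Type*} [CommRing R] {c₁ c₂ : R}

lemma eq_smul_add (z : ℍ[R,c₁,c₂]) :
    z = z.re • 1 + z.imI • ⟨0, 1, 0, 0⟩ + z.imJ • ⟨0, 0, 1, 0⟩ +
      z.imK • (⟨0, 1, 0, 0⟩ * ⟨0, 0, 1, 0⟩ : ℍ[R,c₁,c₂]) := by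
  ext <;> simp

/-- An `R`-linear section of a surjection from a free module commuting with `i` and `j` makes the
target projective over the quaternion order. -/
lemma projective_of_exists_section {M : Type*} [AddCommGroup M] [Module R M]
    [Module ℍ[R,c₁,c₂] M] [IsScalarTower R ℍ[R,c₁,c₂] M]
    (H : ∀ p : (M →₀ ℍ[R,c₁,c₂]) →ₗ[ℍ[R,c₁,c₂]] M, Function.Surjective p →
      ∃ s : M →ₗ[R] (M →₀ ℍ[R,c₁,c₂]), (∀ m, p (s m) = m) ∧
        (∀ m, s ((⟨0, 1, 0, 0⟩ : ℍ[R,c₁,c₂]) • m) = (⟨0, 1, 0, 0⟩ : ℍ[R,c₁,c₂]) • s m) ∧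
        ∀ m, s ((⟨0, 0, 1, 0⟩ : ℍ[R,c₁,c₂]) • m) = (⟨0, 0, 1, 0⟩ : ℍ[R,c₁,c₂]) • s m) :
    Module.Projective ℍ[R,c₁,c₂] M := by
  refine Module.Projective.of_lifting_property'' fun p hp => ?_
  obtain ⟨s, hs, hi, hj⟩ := H p hp
  refine ⟨{ toFun := s, map_add' := map_add s, map_smul' := fun z m => ?_ }, LinearMap.ext hs⟩
  rw [RingHom.id_apply, eq_smul_add z]
  simp only [add_smul, smul_assoc, mul_smul, one_smul, map_add, map_smul, hi, hj]

lemma projective_ideal [IsDomain R] [IsDiscreteValuationRing R] [Invertible (2 : R)]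
    (h₁ : c₁ = 1) (h₂ : c₂ = 1 ∨ Irreducible c₂) (I : Ideal ℍ[R,c₁,c₂]) :
    Module.Projective ℍ[R,c₁,c₂] I := by
  have : IsNoetherian R ℍ[R,c₁,c₂] := isNoetherian_of_isNoetherianRing_of_finite R _
  have : Module.Finite R I :=
    inferInstanceAs (Module.Finite R (I.restrictScalars R))
  have : Module.IsTorsionFree R I :=
    inferInstanceAs (Module.IsTorsionFree R (I.restrictScalars R))
  refine projective_of_exists_section (R := R) fun p hp => ?_
  set i : ℍ[R,c₁,c₂] := ⟨0, 1, 0, 0⟩ with hi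
  set j : ℍ[R,c₁,c₂] := ⟨0, 0, 1, 0⟩ with hj
  have hii : i * i = 1 := by ext <;> simp [hi, h₁]
  have hjj : j * j = c₂ • 1 := by ext <;> simp [hj]
  have hji : j * i = -(i * j) := by ext <;> simp [hi, hj]
  obtain ⟨s, hs, hsj⟩ : ∃ s : I →ₗ[R] (I →₀ ℍ[R,c₁,c₂]), (∀ m, p (s m) = m) ∧
      ∀ m, s (j • m) = j • s m := by
    rcases h₂ with h₂ | h₂
    · obtain ⟨s, hs⟩ := Module.projective_lifting_property (p.restrictScalars R) LinearMap.id hp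
      obtain ⟨s', hs', hs'j, -⟩ := exists_section_comm_of_mul_self_eq_one p s
        (LinearMap.congr_fun hs) j (by rw [hjj, h₂, one_smul])
      exact ⟨s', hs', hs'j⟩
    · refine exists_section_comm_of_irreducible h₂ (Algebra.lsmul R R I j)
        (Algebra.lsmul R R (I →₀ ℍ[R,c₁,c₂]) j) ?_ ?_ (p.restrictScalars R)
        (fun x => map_smul p j x) hp
      · rw [← map_mul, hjj, map_smul, map_one]
      · rw [← map_mul, hjj, map_smul, map_one]
  obtain ⟨s', hs', hs'i, h⟩ := exists_section_comm_of_mul_self_eq_one p s hs i hii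
  exact ⟨s', hs', hs'i, h j hji hsj⟩

/-- If a left ideal containing the scalar `ϖ` is projective, then the dual basis lemma writes `ϖ` as
a sum of products `c * x`, where `x` lies in the ideal and right multiplication by `c` maps the
ideal into multiples of `ϖ`. -/
lemma not_projective_ideal {ϖ : R} (hϖ : ¬ ϖ ^ 2 ∣ ϖ) (I : Ideal ℍ[R,c₁,c₂])
    (hI : ϖ • (1 : ℍ[R,c₁,c₂]) ∈ I)
    (H : ∀ c : ℍ[R,c₁,c₂], (∀ x ∈ I, ∃ y, x * c = ϖ • y) → ∀ x ∈ I, ϖ ^ 2 ∣ (c * x).re) :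
    ¬ Module.Projective ℍ[R,c₁,c₂] I := by
  intro hproj
  obtain ⟨s, hs⟩ := Module.projective_def.mp hproj
  set t : I := ⟨ϖ • 1, hI⟩ with ht
  have hc (a : I) : ∀ x ∈ I, ∃ y, x * s t a = ϖ • y := by
    intro x hx
    refine ⟨s ⟨x, hx⟩ a, ?_⟩
    have h : x • t = ϖ • (⟨x, hx⟩ : I) := Subtype.ext (by simp [ht])
    have h' := congrArg s h
    rw [map_smul, s.map_smul_of_tower ϖ] at h'
    exact DFunLike.congr_fun h' a
  have hsum := congrArg (fun z : I => reₗ c₁ 0 c₂ (z : ℍ[R,c₁,c₂])) (hs t)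
  apply hϖ
  have hre : ϖ = ∑ a ∈ (s t).support, (s t a * (a : ℍ[R,c₁,c₂])).re := by
    simpa [Finsupp.linearCombination_apply, Finsupp.sum, ht] using hsum.symm
  nth_rewrite 2 [hre]
  exact Finset.dvd_sum fun a _ => H _ (hc a) a a.2

lemma exists_ideal_not_projective_of_sq_dvd {ϖ : R} (hϖ : ¬ ϖ ^ 2 ∣ ϖ) (h₂ : ϖ ^ 2 ∣ c₂) :
    ∃ I : Ideal ℍ[R,c₁,c₂], ¬ Module.Projective ℍ[R,c₁,c₂] I := by
  obtain ⟨d, rfl⟩ := h₂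
  let I : Ideal ℍ[R,c₁,ϖ ^ 2 * d] :=
    { carrier := {x | ϖ ∣ x.re ∧ ϖ ∣ x.imI}
      zero_mem' := by simp
      add_mem' := fun hx hy => ⟨dvd_add hx.1 hy.1, dvd_add hx.2 hy.2⟩
      smul_mem' := by
        rintro a x ⟨⟨r, hr⟩, ⟨s, hs⟩⟩
        refine ⟨?_, ?_⟩
        · refine ⟨a.re * r + c₁ * a.imI * s + ϖ * d * a.imJ * x.imJ
            - c₁ * (ϖ * d) * a.imK * x.imK, ?_⟩
          simp [hr, hs]
          ring
        · refine ⟨a.re * s + a.imI * r - ϖ * d * a.imJ * x.imK + ϖ * d * a.imK * x.imJ, ?_⟩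
          simp [hr, hs]
          ring }
  refine ⟨I, not_projective_ideal hϖ I ⟨by simp, by simp⟩ ?_⟩
  rintro c hc x ⟨⟨r, hr⟩, ⟨s, hs⟩⟩
  obtain ⟨y, hy⟩ := hc ⟨0, 0, 1, 0⟩ ⟨by simp, by simp⟩
  have h₁ := congrArg imJ hy
  have h₂ := congrArg imK hy
  simp at h₁ h₂
  refine ⟨y.imJ * r - c₁ * y.imK * s + d * c.imJ * x.imJ - c₁ * d * c.imK * x.imK, ?_⟩
  have h₃ : c.imI = -(ϖ * y.imK) := by rw [← h₂, neg_neg]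
  simp [h₁, h₃, hr, hs]
  ring

lemma exists_ideal_not_projective_of_dvd {ϖ : R} (hϖ : ¬ ϖ ^ 2 ∣ ϖ) (h₁ : ϖ ∣ c₁) (h₂ : ϖ ∣ c₂) :
    ∃ I : Ideal ℍ[R,c₁,c₂], ¬ Module.Projective ℍ[R,c₁,c₂] I := by
  obtain ⟨b, rfl⟩ := h₁
  obtain ⟨d, rfl⟩ := h₂
  let I : Ideal ℍ[R,ϖ * b,ϖ * d] :=
    { carrier := {x | ϖ ∣ x.re}
      zero_mem' := by simp
      add_mem' := fun hx hy => dvd_add hx hy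
      smul_mem' := by
        rintro a x ⟨r, hr⟩
        refine ⟨a.re * r + b * a.imI * x.imI + d * a.imJ * x.imJ
          - b * (ϖ * d) * a.imK * x.imK, ?_⟩
        simp [hr]
        ring }
  refine ⟨I, not_projective_ideal hϖ I (by simp [I]) ?_⟩
  rintro c hc x ⟨r, hr⟩
  obtain ⟨y, hy⟩ := hc ⟨0, 0, 1, 0⟩ (by simp [I])
  obtain ⟨z, hz⟩ := hc ⟨0, 1, 0, 0⟩ (by simp [I])
  have h₁ := congrArg imJ hy
  have h₂ := congrArg imK hy
  have h₃ := congrArg imK hz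
  simp at h₁ h₂ h₃
  have h₄ : c.imI = -(ϖ * y.imK) := by rw [← h₂, neg_neg]
  refine ⟨y.imJ * r - b * y.imK * x.imI + d * z.imK * x.imJ - b * d * c.imK * x.imK, ?_⟩
  simp [h₁, h₄, h₃, hr]
  ring

end QuaternionAlgebra

/-- The quaternion order `Λ(e₁,e₂) = ℍ[k⟦t⟧, t^e₁, t^e₂]` (with `e₁ ≤ e₂`)
is hereditary — every left ideal is projective as a left module — iff `e₁ = 0` and `e₂ ≤ 1`. -/
theorem quaternion_order_hereditary_iff
    {k : Type*} [Field k] [CharZero k] [IsAlgClosed k]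
    (e₁ e₂ : ℕ) (h : e₁ ≤ e₂) :
    (∀ I : Ideal ℍ[PowerSeries k, (X : PowerSeries k) ^ e₁, (X : PowerSeries k) ^ e₂],
        Module.Projective ℍ[PowerSeries k, (X : PowerSeries k) ^ e₁, (X : PowerSeries k) ^ e₂] I)
      ↔ (e₁ = 0 ∧ e₂ ≤ 1) := by
  have hX : Irreducible (X : PowerSeries k) := X_irreducible
  constructor
  · intro H
    have hsq : ¬ (X : PowerSeries k) ^ 2 ∣ X := fun hd => by
      have := (pow_dvd_pow_iff hX.ne_zero hX.not_isUnit).mp (hd.trans (pow_one X).symm.dvd)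
      omega
    have he₂ : e₂ ≤ 1 := by
      by_contra! he
      obtain ⟨I, hI⟩ := QuaternionAlgebra.exists_ideal_not_projective_of_sq_dvd
        (c₁ := (X : PowerSeries k) ^ e₁) hsq (pow_dvd_pow X he)
      exact hI (H I)
    refine ⟨?_, he₂⟩
    by_contra he
    obtain ⟨I, hI⟩ := QuaternionAlgebra.exists_ideal_not_projective_of_dvd hsq
      (dvd_pow_self (X : PowerSeries k) he) (dvd_pow_self (X : PowerSeries k) (n := e₂) (by omega))
    exact hI (H I)
  · rintro ⟨rfl, he⟩ I
    let : Invertible (2 : PowerSeries k) :=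
      ((Invertible.map (C (R := k)) 2).copy 2 (map_ofNat _ 2).symm)
    refine QuaternionAlgebra.projective_ideal (pow_zero _) ?_ I
    interval_cases e₂
    · exact Or.inl (pow_zero _)
    · exact Or.inr (by rwa [pow_one])
end
end

section
/- Let e₁ ≤ e₂ be nonnegative integers and let Λ(e₁,e₂) = ℍ[R, t^{e₁}, t^{e₂}] be the corresponding quaternion order over R = k⟦t⟧. Then Λ(e₁,e₂) contains an idempotent element different from 0 and 1 (equivalently, Λ(e₁,e₂) is a tiled order, possessing a complete set of 2 primitive orthogonal idempotents) if and only if e₁ = 0. -/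
open scoped Quaternion
open PowerSeries

noncomputable section

/-- Over a domain, every idempotent of `ℍ[R, a, b]` other than `0` and `1` has reduced trace `1`. -/
theorem two_mul_re_eq_one_of_idempotent {R : Type*} [CommRing R] [IsDomain R] {a b : R}
    {x : ℍ[R, a, b]} (hx : x * x = x) (h0 : x ≠ 0) (h1 : x ≠ 1) : 2 * x.re = 1 := by
  by_contra hre
  have hre' : 2 * x.re - 1 ≠ 0 := sub_ne_zero.mpr hre
  have er := congrArg QuaternionAlgebra.re hx
  have ei := congrArg QuaternionAlgebra.imI hx
  have ej := congrArg QuaternionAlgebra.imJ hx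
  have ek := congrArg QuaternionAlgebra.imK hx
  simp only [QuaternionAlgebra.re_mul, QuaternionAlgebra.imI_mul, QuaternionAlgebra.imJ_mul,
    QuaternionAlgebra.imK_mul] at er ei ej ek
  have hi : x.imI = 0 := (mul_eq_zero.mp (by linear_combination ei)).resolve_left hre'
  have hj : x.imJ = 0 := (mul_eq_zero.mp (by linear_combination ej)).resolve_left hre'
  have hk : x.imK = 0 := (mul_eq_zero.mp (by linear_combination ek)).resolve_left hre'
  rw [hi, hj, hk] at er
  have hr : x.re * (x.re - 1) = 0 := by linear_combination er
  rcases mul_eq_zero.mp hr with hr | hr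
  · exact h0 (by ext <;> simp [hi, hj, hk, hr])
  · exact h1 (by ext <;> simp [hi, hj, hk, sub_eq_zero.mp hr])

/-- The quaternion order `Λ(e₁,e₂) = ℍ[k⟦t⟧, t^e₁, t^e₂]` (with `e₁ ≤ e₂`)
contains an idempotent different from `0` and `1` iff `e₁ = 0`. -/
theorem quaternion_order_has_nontrivial_idempotent_iff
    {k : Type*} [Field k] [CharZero k] [IsAlgClosed k]
    (e₁ e₂ : ℕ) (h : e₁ ≤ e₂) :
    (∃ x : ℍ[PowerSeries k, (X : PowerSeries k) ^ e₁, (X : PowerSeries k) ^ e₂],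
        x * x = x ∧ x ≠ 0 ∧ x ≠ 1)
      ↔ e₁ = 0 := by
  constructor
  · rintro ⟨x, hx, h0, h1⟩
    by_contra he₁
    have he₂ : e₂ ≠ 0 := by omega
    have htr := congrArg (constantCoeff (R := k)) (two_mul_re_eq_one_of_idempotent hx h0 h1)
    have her := congrArg (constantCoeff (R := k)) (congrArg QuaternionAlgebra.re hx)
    simp only [QuaternionAlgebra.re_mul, map_add, map_sub, map_mul, map_pow, map_one, map_zero,
      map_ofNat, constantCoeff_X, zero_pow he₁, zero_pow he₂] at htr her
    exact one_ne_zero (α := k) (by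
      linear_combination (2 * constantCoeff x.re - 1) * htr - 4 * her)
  · rintro rfl
    have hc : (C (2⁻¹ : k)) + C (2⁻¹ : k) = 1 := by
      rw [← map_add, ← map_one C]
      congr 1
      norm_num
    have hc0 : C (2⁻¹ : k) ≠ 0 := by
      intro hz
      simp [hz] at hc
    refine ⟨⟨C 2⁻¹, C 2⁻¹, 0, 0⟩, ?_, fun hx => hc0 (congrArg QuaternionAlgebra.imI hx),
      fun hx => hc0 (congrArg QuaternionAlgebra.imI hx)⟩
    ext1
    · simp only [QuaternionAlgebra.re_mul]
      linear_combination C (2⁻¹ : k) * hc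
    · simp only [QuaternionAlgebra.imI_mul]
      linear_combination C (2⁻¹ : k) * hc
    · simp
    · simp
end
end

section
/- Let e₁ ≤ e₂ and f₁ ≤ f₂ be nonnegative integers. The quaternion orders Λ(e₁,e₂) = ℍ[R, t^{e₁}, t^{e₂}] and Λ(f₁,f₂) = ℍ[R, t^{f₁}, t^{f₂}] over R = k⟦t⟧ are isomorphic as R-algebras if and only if (e₁,e₂) = (f₁,f₂). -/
open scoped Quaternion
open PowerSeries

noncomputable section

namespace QuaternionAlgebra

variable {R : Type*} [CommRing R] [IsDomain R] {a b c d : R}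

/-- A quaternion with nonzero scalar square that anticommutes with a quaternion of nonzero scalar
square has zero real part. -/
theorem re_eq_zero_of_anticommute (h2 : (2 : R) ≠ 0) {u v : ℍ[R, a, b]}
    (hu : u * u = algebraMap R ℍ[R, a, b] c) (hv : v * v = algebraMap R ℍ[R, a, b] d)
    (huv : u * v = -(v * u)) (hd : d ≠ 0) : u.re = 0 := by
  by_contra hre
  have h2re : 2 * u.re ≠ 0 := mul_ne_zero h2 hre
  have hI : u.imI = 0 := by
    have h := congrArg QuaternionAlgebra.imI hu
    simp at h
    exact (mul_eq_zero.mp (by linear_combination h : 2 * u.re * u.imI = 0)).resolve_left h2re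
  have hJ : u.imJ = 0 := by
    have h := congrArg QuaternionAlgebra.imJ hu
    simp at h
    exact (mul_eq_zero.mp (by linear_combination h : 2 * u.re * u.imJ = 0)).resolve_left h2re
  have hK : u.imK = 0 := by
    have h := congrArg QuaternionAlgebra.imK hu
    simp at h
    exact (mul_eq_zero.mp (by linear_combination h : 2 * u.re * u.imK = 0)).resolve_left h2re
  have hv0 : v = 0 := by
    ext
    · have h := congrArg QuaternionAlgebra.re huv
      simp [hI, hJ, hK] at h
      exact (mul_eq_zero.mp (by linear_combination h : 2 * u.re * v.re = 0)).resolve_left h2re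
    · have h := congrArg QuaternionAlgebra.imI huv
      simp [hI, hJ, hK] at h
      exact (mul_eq_zero.mp (by linear_combination h : 2 * u.re * v.imI = 0)).resolve_left h2re
    · have h := congrArg QuaternionAlgebra.imJ huv
      simp [hI, hJ, hK] at h
      exact (mul_eq_zero.mp (by linear_combination h : 2 * u.re * v.imJ = 0)).resolve_left h2re
    · have h := congrArg QuaternionAlgebra.imK huv
      simp [hI, hJ, hK] at h
      exact (mul_eq_zero.mp (by linear_combination h : 2 * u.re * v.imK = 0)).resolve_left h2re
  have h := congrArg QuaternionAlgebra.re hv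
  simp [hv0] at h
  exact hd h.symm

/-- An algebra homomorphism `ℍ[R, c, d] → ℍ[R, a, b]` forces divisibilities between the
structure constants. -/
theorem dvd_of_algHom (h2 : (2 : R) ≠ 0) (hc : c ≠ 0) (hd : d ≠ 0) (hab : a ∣ b)
    (φ : ℍ[R, c, d] →ₐ[R] ℍ[R, a, b]) : a ∣ c ∧ a * b ∣ c * d := by
  obtain ⟨u, hu'⟩ : ∃ u, u = φ ⟨0, 1, 0, 0⟩ := ⟨_, rfl⟩
  obtain ⟨v, hv'⟩ : ∃ v, v = φ ⟨0, 0, 1, 0⟩ := ⟨_, rfl⟩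
  have hu : u * u = algebraMap R _ c := by
    rw [hu', ← map_mul, ← φ.commutes]
    congr 1
    ext <;> simp
  have hv : v * v = algebraMap R _ d := by
    rw [hv', ← map_mul, ← φ.commutes]
    congr 1
    ext <;> simp
  have huv : u * v = -(v * u) := by
    rw [hu', hv', ← map_mul, ← map_mul, ← map_neg]
    congr 1
    ext <;> simp
  have hu0 := re_eq_zero_of_anticommute h2 hu hv huv hd
  have hv0 := re_eq_zero_of_anticommute h2 hv hu (by rw [huv, neg_neg]) hc
  have hc' := congrArg QuaternionAlgebra.re hu
  have hd' := congrArg QuaternionAlgebra.re hv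
  have h0 := congrArg QuaternionAlgebra.re huv
  simp [hu0, hv0] at hc' hd' h0
  have h0' : a * u.imI * v.imI + b * u.imJ * v.imJ - a * b * u.imK * v.imK = 0 :=
    (mul_eq_zero.mp (by linear_combination h0 :
      2 * (a * u.imI * v.imI + b * u.imJ * v.imJ - a * b * u.imK * v.imK) = 0)).resolve_left h2
  constructor
  · obtain ⟨m, rfl⟩ := hab
    exact ⟨u.imI ^ 2 + m * u.imJ ^ 2 - a * m * u.imK ^ 2, by linear_combination -hc'⟩
  · refine ⟨(u.imI * v.imJ - u.imJ * v.imI) ^ 2 - b * (u.imJ * v.imK - u.imK * v.imJ) ^ 2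
      - a * (u.imI * v.imK - u.imK * v.imI) ^ 2, ?_⟩
    rw [← hc', ← hd']
    linear_combination
      (a * u.imI * v.imI + b * u.imJ * v.imJ - a * b * u.imK * v.imK) * h0'

end QuaternionAlgebra

/-- An algebra homomorphism between quaternion orders over `k⟦t⟧` bounds the exponents of the
target by those of the source. -/
theorem exponents_le_of_quaternion_algHom {k : Type*} [Field k] [CharZero k] {e₁ e₂ f₁ f₂ : ℕ}
    (hf : f₁ ≤ f₂)
    (φ : ℍ[PowerSeries k, (X : PowerSeries k) ^ e₁, (X : PowerSeries k) ^ e₂] →ₐ[PowerSeries k]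
      ℍ[PowerSeries k, (X : PowerSeries k) ^ f₁, (X : PowerSeries k) ^ f₂]) :
    f₁ ≤ e₁ ∧ f₁ + f₂ ≤ e₁ + e₂ := by
  have h2 : (2 : PowerSeries k) ≠ 0 := by
    intro h
    have h' := congrArg (constantCoeff (R := k)) h
    rw [map_ofNat, map_zero] at h'
    exact two_ne_zero h'
  obtain ⟨h₁, h₂⟩ := QuaternionAlgebra.dvd_of_algHom h2 (pow_ne_zero _ X_ne_zero)
    (pow_ne_zero _ X_ne_zero) (pow_dvd_pow _ hf) φ
  rw [← pow_add, ← pow_add] at h₂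
  exact ⟨(pow_dvd_pow_iff X_ne_zero X_prime.not_isUnit).mp h₁,
    (pow_dvd_pow_iff X_ne_zero X_prime.not_isUnit).mp h₂⟩

/-- For `e₁ ≤ e₂` and `f₁ ≤ f₂`, the quaternion orders
`ℍ[k⟦t⟧, t^e₁, t^e₂]` and `ℍ[k⟦t⟧, t^f₁, t^f₂]` are isomorphic as `k⟦t⟧`-algebras iff
`(e₁, e₂) = (f₁, f₂)`. -/
theorem quaternion_orders_isomorphic_iff
    {k : Type*} [Field k] [CharZero k] [IsAlgClosed k]
    (e₁ e₂ f₁ f₂ : ℕ) (he : e₁ ≤ e₂) (hf : f₁ ≤ f₂) :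
    Nonempty
        (ℍ[PowerSeries k, (X : PowerSeries k) ^ e₁, (X : PowerSeries k) ^ e₂] ≃ₐ[PowerSeries k]
          ℍ[PowerSeries k, (X : PowerSeries k) ^ f₁, (X : PowerSeries k) ^ f₂])
      ↔ (e₁ = f₁ ∧ e₂ = f₂) := by
  constructor
  · rintro ⟨φ⟩
    have h₁ := exponents_le_of_quaternion_algHom hf φ.toAlgHom
    have h₂ := exponents_le_of_quaternion_algHom he φ.symm.toAlgHom
    omega
  · rintro ⟨rfl, rfl⟩
    exact ⟨AlgEquiv.refl⟩
end
end
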